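/- Let X and Y be compact Hausdorff connected topological spaces and let p : Y → X be a continuous surjection. Regard the C*-algebra C(Y,ℂ) of continuous complex-valued functions on Y as a module over C(X,ℂ) via the pullback *-homomorphism p* : C(X,ℂ) → C(Y,ℂ), f ↦ f ∘ p (so that (f·ξ)(y) = ξ(y)·f(p(y))). If C(Y,ℂ) is a finitely generated projective C(X,ℂ)-module, then p is a finite-fold covering: p is a covering map and every fiber p⁻¹(x) is finite. -/

import Mathlib

/-- A finite dual basis of `C(Y, ℂ)` over `C(X, ℂ)`, where functions on `X` act on functions
on `Y` by pullback along `p`. -/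
structure PullbackDualBasis {X Y : Type*} [TopologicalSpace X] [TopologicalSpace Y]
    (p : C(Y, X)) (n : ℕ) where
  /-- The generators. -/
  gen : Fin n → C(Y, ℂ)
  /-- The coordinate functionals. -/
  coord : Fin n → C(Y, ℂ) →+ C(X, ℂ)
  coord_comp_mul : ∀ i (f : C(X, ℂ)) (ξ : C(Y, ℂ)), coord i (f.comp p * ξ) = f * coord i ξ
  sum_coord : ∀ ξ : C(Y, ℂ), ∑ i, (coord i ξ).comp p * gen i = ξ

/-- A finitely generated projective module has a finite dual basis. -/
theorem exists_pullbackDualBasis {X Y : Type*} [TopologicalSpace X] [TopologicalSpace Y]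
    (p : C(Y, X)) (φ : C(X, ℂ) →+* C(Y, ℂ)) (hφ : ∀ f : C(X, ℂ), φ f = f.comp p)
    (hfin : @Module.Finite C(X, ℂ) C(Y, ℂ) _ _ (Module.compHom C(Y, ℂ) φ))
    (hproj : @Module.Projective C(X, ℂ) _ C(Y, ℂ) _ (Module.compHom C(Y, ℂ) φ)) :
    ∃ n, Nonempty (PullbackDualBasis p n) := by
  let _ : Module C(X, ℂ) C(Y, ℂ) := Module.compHom C(Y, ℂ) φ
  have hsmul (f : C(X, ℂ)) (ξ : C(Y, ℂ)) : f • ξ = f.comp p * ξ := by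
    rw [← hφ]; rfl
  obtain ⟨n, q, c, -, -, hqc⟩ := Module.Finite.exists_comp_eq_id_of_projective C(X, ℂ) C(Y, ℂ)
  refine ⟨n, ⟨⟨fun i ↦ q (Pi.single i 1), fun i ↦ ((LinearMap.proj i).comp c).toAddMonoidHom,
    fun i f ξ ↦ ?_, fun ξ ↦ ?_⟩⟩⟩
  · simpa [hsmul] using congrFun (c.map_smul f ξ) i
  · conv_rhs => rw [← LinearMap.id_apply (R := C(X, ℂ)) ξ, ← hqc, LinearMap.comp_apply,
      LinearMap.pi_apply_eq_sum_univ q (c ξ)]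
    refine Finset.sum_congr rfl fun i _ ↦ ?_
    rw [hsmul]
    congr 2
    ext j
    simp [Pi.single_apply, eq_comm]

/-- A bump function at `y` supported in an open neighbourhood of `y`. -/
theorem exists_bump {Y : Type*} [TopologicalSpace Y] [CompactSpace Y] [T2Space Y]
    {V : Set Y} (hV : IsOpen V) {y : Y} (hy : y ∈ V) :
    ∃ b : C(Y, ℝ), b y = 1 ∧ (∀ z ∉ V, b z = 0) ∧ ∀ z, b z ∈ Set.Icc (0 : ℝ) 1 := by
  obtain ⟨b, h0, h1, hb⟩ := exists_continuous_zero_one_of_isClosed hV.isClosed_compl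
    (isClosed_singleton (x := y)) (by simpa using hy)
  exact ⟨b, h1 rfl, fun z hz ↦ h0 hz, hb⟩

/-- The complexification of a real continuous function. -/
noncomputable def ContinuousMap.toComplex {Y : Type*} [TopologicalSpace Y] (b : C(Y, ℝ)) :
    C(Y, ℂ) :=
  ⟨fun y ↦ (b y : ℂ), by fun_prop⟩

@[simp]
theorem ContinuousMap.toComplex_apply {Y : Type*} [TopologicalSpace Y] (b : C(Y, ℝ)) (y : Y) :
    b.toComplex y = (b y : ℂ) := rfl

/-- Points of a finite set can be isolated by a continuous function. -/
theorem exists_eq_one_of_finset {Y : Type*} [TopologicalSpace Y] [CompactSpace Y] [T2Space Y]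
    (S : Finset Y) (y : Y) :
    ∃ b : C(Y, ℂ), b y = 1 ∧ ∀ z ∈ S, z ≠ y → b z = 0 := by
  classical
  obtain ⟨b, h1, h0, -⟩ := exists_bump (S.erase y).finite_toSet.isClosed.isOpen_compl
    (y := y) (by simp)
  exact ⟨b.toComplex, by simp [h1], fun z hz hzy ↦ by
    simp [h0 z (by simp [hz, hzy])]⟩

namespace PullbackDualBasis

variable {X Y : Type*} [TopologicalSpace X] [TopologicalSpace Y]
  [CompactSpace Y] [T2Space Y] {p : C(Y, X)} {n : ℕ}

/-- The generators separate the points of a fiber linearly, so fibers are finite. -/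
theorem finite_fiber (B : PullbackDualBasis p n) (x : X) : (p ⁻¹' {x}).Finite := by
  have hli : LinearIndependent ℂ (fun (y : p ⁻¹' {x}) (i : Fin n) ↦ B.gen i y) := by
    classical
    rw [linearIndependent_iff']
    intro S w hw y hy
    obtain ⟨b, hb1, hb0⟩ := exists_eq_one_of_finset (S.image Subtype.val) (y : Y)
    have hb (z : p ⁻¹' {x}) : b z = ∑ i, B.coord i b x * B.gen i z := by
      have hz : p z = x := z.2
      conv_lhs => rw [← B.sum_coord b]
      simp [hz]
    have hsum : ∑ z ∈ S, w z * b z = 0 := by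
      simp_rw [hb, Finset.mul_sum]
      rw [Finset.sum_comm]
      refine Finset.sum_eq_zero fun i _ ↦ ?_
      have := congrFun hw i
      simp only [Finset.sum_apply, Pi.smul_apply, smul_eq_mul, Pi.zero_apply] at this
      calc ∑ z ∈ S, w z * (B.coord i b x * B.gen i z)
          = B.coord i b x * ∑ z ∈ S, w z * B.gen i z := by
            rw [Finset.mul_sum]; exact Finset.sum_congr rfl fun z _ ↦ by ring
        _ = 0 := by rw [this, mul_zero]
    rw [Finset.sum_eq_single_of_mem y hy fun z hz hzy ↦ ?_] at hsum
    · simpa [hb1] using hsum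
    · rw [hb0 z (Finset.mem_image_of_mem _ hz) (fun h ↦ hzy (Subtype.ext h)), mul_zero]
  exact Set.finite_coe_iff.1 hli.finite

/-- Given a neighbourhood of `y`, there is a bump function supported in it whose sum over the
fiber of `y` equals `1`. -/
theorem exists_bump_sum_fiber (B : PullbackDualBasis p n) {V : Set Y} (hV : IsOpen V) {y : Y}
    (hy : y ∈ V) :
    ∃ b : C(Y, ℝ), b y = 1 ∧ (∀ z ∉ V, b z = 0) ∧ (∀ z, 0 ≤ b z) ∧
      ∑ z ∈ (B.finite_fiber (p y)).toFinset, b z = 1 := by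
  have hF : IsOpen ((p ⁻¹' {p y} \ {y})ᶜ) :=
    ((B.finite_fiber (p y)).subset Set.sdiff_subset).isClosed.isOpen_compl
  obtain ⟨b, hb1, hb0, hb⟩ := exists_bump (hV.inter hF) (y := y) ⟨hy, by simp⟩
  refine ⟨b, hb1, fun z hz ↦ hb0 z fun h ↦ hz h.1, fun z ↦ (hb z).1, ?_⟩
  rw [Finset.sum_eq_single_of_mem y (by simp) fun z hz hzy ↦ hb0 z fun h ↦
    h.2 ⟨by simpa using hz, hzy⟩, hb1]

variable [CompactSpace X] [T2Space X]

/-- The coordinate functionals are continuous, by the open mapping theorem. -/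
theorem continuous_coord (B : PullbackDualBasis p n) (i : Fin n) : Continuous (B.coord i) := by
  let q : (Fin n → C(X, ℂ)) →L[ℂ] C(Y, ℂ) :=
    { toFun := fun a ↦ ∑ j, (a j).comp p * B.gen j
      map_add' := fun a b ↦ by
        ext y; simp [add_mul, Finset.sum_add_distrib]
      map_smul' := fun r a ↦ by
        ext y; simp [Finset.mul_sum]
      cont := by fun_prop }
  have hq : Function.Surjective q := fun ξ ↦ ⟨fun j ↦ B.coord j ξ, B.sum_coord ξ⟩
  rw [(q.isQuotientMap hq).continuous_iff]
  have : B.coord i ∘ q = fun a ↦ ∑ j, a j * B.coord i (B.gen j) := by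
    ext1 a
    simp [q, B.coord_comp_mul]
  rw [this]
  fun_prop

/-- The value of a coordinate at `x` depends only on the restriction to the fiber over `x`. -/
theorem coord_apply_eq_zero (B : PullbackDualBasis p n) (i : Fin n) (x : X) (ξ : C(Y, ℂ))
    (hξ : ∀ y, p y = x → ξ y = 0) :
    B.coord i ξ x = 0 := by
  have hmem : ξ ∈ closure {ζ : C(Y, ℂ) | B.coord i ζ x = 0} := by
    rw [Metric.mem_closure_iff]
    intro ε hε
    have hC : IsClosed (p '' {y | ε / 2 ≤ ‖ξ y‖}) :=
      p.continuous.isClosedMap _ (isClosed_le continuous_const (by fun_prop))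
    have hxC : x ∈ (p '' {y | ε / 2 ≤ ‖ξ y‖})ᶜ := by
      rintro ⟨y, hy, hyx⟩
      simp only [Set.mem_ofPred_eq, hξ y hyx, norm_zero] at hy
      linarith
    obtain ⟨b, hb1, hb0, hb⟩ := exists_bump hC.isOpen_compl hxC
    refine ⟨(1 - b.toComplex).comp p * ξ, ?_, ?_⟩
    · rw [Set.mem_ofPred_eq, B.coord_comp_mul]
      simp [hb1]
    · refine lt_of_le_of_lt ((ContinuousMap.dist_le (by positivity)).2 fun y ↦ ?_)
        (half_lt_self hε)
      have hdist : dist (ξ y) (((1 - b.toComplex).comp p * ξ) y) = b (p y) * ‖ξ y‖ := by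
        have : ξ y - (1 - (b (p y) : ℂ)) * ξ y = (b (p y) : ℂ) * ξ y := by ring
        simp [dist_eq_norm, this, abs_of_nonneg (hb (p y)).1]
      rw [hdist]
      by_cases hy : ε / 2 ≤ ‖ξ y‖
      · rw [hb0 (p y) (fun h ↦ h ⟨y, hy, rfl⟩)]
        simpa using (half_pos hε).le
      · exact (mul_le_of_le_one_left (norm_nonneg _) (hb (p y)).2).trans (not_le.1 hy).le
  have hcl : IsClosed {ζ : C(Y, ℂ) | B.coord i ζ x = 0} :=
    isClosed_eq ((continuous_eval_const x).comp (B.continuous_coord i)) continuous_const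
  exact hcl.closure_subset hmem

/-- The trace of multiplication by `ξ`. -/
noncomputable def trace (B : PullbackDualBasis p n) (ξ : C(Y, ℂ)) : C(X, ℂ) :=
  ∑ i, B.coord i (ξ * B.gen i)

/-- The trace is the sum over the fibers. -/
theorem trace_apply (B : PullbackDualBasis p n) (ξ : C(Y, ℂ)) (x : X) :
    B.trace ξ x = ∑ y ∈ (B.finite_fiber x).toFinset, ξ y := by
  classical
  set S := (B.finite_fiber x).toFinset with hS
  have hmem (y : Y) : y ∈ S ↔ p y = x := by simp [hS]
  choose b hb1 hb0 using exists_eq_one_of_finset S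
  have hcoord (i : Fin n) (ζ : C(Y, ℂ)) :
      B.coord i ζ x = ∑ y ∈ S, ζ y * B.coord i (b y) x := by
    have h := B.coord_apply_eq_zero i x
      (ζ - ∑ y ∈ S, (ContinuousMap.const X (ζ y)).comp p * b y) fun z hz ↦ by
        have hzS := (hmem z).2 hz
        simp only [ContinuousMap.sub_apply, ContinuousMap.sum_apply, ContinuousMap.mul_apply,
          ContinuousMap.comp_apply, ContinuousMap.const_apply]
        rw [Finset.sum_eq_single_of_mem z hzS fun y _ hyz ↦ by
          rw [hb0 y z hzS hyz.symm, mul_zero], hb1, mul_one, sub_self]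
    rw [map_sub, map_sum, ContinuousMap.sub_apply, sub_eq_zero] at h
    simp_rw [h, B.coord_comp_mul]
    simp
  have hdelta (y : Y) (hy : y ∈ S) : ∑ i, B.coord i (b y) x * B.gen i y = 1 := by
    have h := congrArg (fun ζ : C(Y, ℂ) ↦ ζ y) (B.sum_coord (b y))
    simpa [(hmem y).1 hy, hb1] using h
  simp only [trace, ContinuousMap.sum_apply]
  simp_rw [hcoord _ (ξ * _)]
  rw [Finset.sum_comm]
  refine Finset.sum_congr rfl fun y hy ↦ ?_
  calc ∑ i, (ξ * B.gen i) y * B.coord i (b y) x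
      = ξ y * ∑ i, B.coord i (b y) x * B.gen i y := by
        rw [Finset.mul_sum]
        exact Finset.sum_congr rfl fun i _ ↦ by rw [ContinuousMap.mul_apply]; ring
    _ = ξ y := by rw [hdelta y hy, mul_one]

/-- Sums of a continuous function over the fibers depend continuously on the base point. -/
theorem continuous_sum_fiber (B : PullbackDualBasis p n) (b : C(Y, ℝ)) :
    Continuous fun x ↦ ∑ y ∈ (B.finite_fiber x).toFinset, b y := by
  refine (Complex.continuous_re.comp (B.trace b.toComplex).continuous).congr fun x ↦ ?_
  simp [trace_apply]

theorem isOpenMap (B : PullbackDualBasis p n) : IsOpenMap p := by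
  rw [isOpenMap_iff_nhds_le]
  intro y N hN
  obtain ⟨V, hVN, hV, hyV⟩ := mem_nhds_iff.1 hN
  obtain ⟨b, -, hb0, -, hsum⟩ := B.exists_bump_sum_fiber hV hyV
  filter_upwards [(B.continuous_sum_fiber b).continuousAt.eventually_ne
    (hsum.trans_ne one_ne_zero)] with x hx
  obtain ⟨z, hz, hbz⟩ := Finset.exists_ne_zero_of_sum_ne_zero hx
  have hzx : p z = x := by simpa using hz
  exact hzx ▸ hVN (not_not.1 fun h ↦ hbz (hb0 z h))

theorem exists_open_injOn (B : PullbackDualBasis p n) (y : Y) :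
    ∃ U : Set Y, IsOpen U ∧ y ∈ U ∧ Set.InjOn p U := by
  classical
  obtain ⟨b, hb1, -, hb, hsum⟩ := B.exists_bump_sum_fiber isOpen_univ (Set.mem_univ y)
  have hcont := (B.continuous_sum_fiber b).comp p.continuous
  refine ⟨{z | 3 / 4 < b z} ∩ {z | ∑ w ∈ (B.finite_fiber (p z)).toFinset, b w < 3 / 2},
    (isOpen_lt continuous_const b.continuous).inter (isOpen_lt hcont continuous_const),
    ⟨by norm_num [hb1], by norm_num [hsum]⟩, fun z hz w hw hzw ↦ ?_⟩
  by_contra hne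
  have hle : ∑ v ∈ {z, w}, b v ≤ ∑ v ∈ (B.finite_fiber (p z)).toFinset, b v :=
    Finset.sum_le_sum_of_subset_of_nonneg
      (Finset.insert_subset_iff.2 (by simp [hzw])) fun v _ _ ↦ hb v
  rw [Finset.sum_pair hne] at hle
  have hz1 : 3 / 4 < b z := hz.1
  have hw1 : 3 / 4 < b w := hw.1
  have hz2 : ∑ v ∈ (B.finite_fiber (p z)).toFinset, b v < 3 / 2 := hz.2
  linarith

theorem isLocalHomeomorph (B : PullbackDualBasis p n) : IsLocalHomeomorph p := by
  rw [isLocalHomeomorph_iff_isOpenEmbedding_restrict]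
  intro y
  obtain ⟨U, hU, hyU, hinj⟩ := B.exists_open_injOn y
  exact ⟨U, hU.mem_nhds hyU, .of_continuous_injective_isOpenMap
    (p.continuous.comp continuous_subtype_val) hinj.injective
    (B.isOpenMap.comp hU.isOpenMap_subtype_val)⟩

end PullbackDualBasis

/-- Let `X` and `Y` be compact Hausdorff connected topological spaces and
`p : Y → X` a continuous surjection.  Regard `C(Y, ℂ)` as a module over `C(X, ℂ)` via the
pullback ring homomorphism `φ : C(X, ℂ) →+* C(Y, ℂ)`, `f ↦ f ∘ p` (so that
`(f • ξ) (y) = ξ y * f (p y)`).  If `C(Y, ℂ)` is a finitely generated projective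
`C(X, ℂ)`-module, then `p` is a finite-fold covering: it is a covering map and all of its
fibers are finite. -/
theorem pavlov_troitsky_finite_fold_covering
    {X Y : Type} [TopologicalSpace X] [TopologicalSpace Y]
    [CompactSpace X] [T2Space X] [ConnectedSpace X]
    [CompactSpace Y] [T2Space Y] [ConnectedSpace Y]
    (p : C(Y, X)) (hsurj : Function.Surjective p)
    (φ : C(X, ℂ) →+* C(Y, ℂ)) (hφ : ∀ f : C(X, ℂ), φ f = f.comp p)
    (hfin : @Module.Finite C(X, ℂ) C(Y, ℂ) _ _ (Module.compHom C(Y, ℂ) φ))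
    (hproj : @Module.Projective C(X, ℂ) _ C(Y, ℂ) _ (Module.compHom C(Y, ℂ) φ)) :
    IsCoveringMap p ∧ ∀ x : X, (p ⁻¹' {x}).Finite := by
  obtain ⟨n, ⟨B⟩⟩ := exists_pullbackDualBasis p φ hφ hfin hproj
  exact ⟨isLocalHomeomorph_iff_isCoveringMap.1 B.isLocalHomeomorph, B.finite_fiber⟩
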